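/- Let O be the ring of integers of an imaginary quadratic field with complex conjugation σ, and let p be a rational prime that splits in O, say pO = (π)·(σ(π)) with (π) ≠ (σ(π)) prime, and set κ = O/(π) ≅ F_p. Then for all k, ℓ ≥ 0 there is an isomorphism of SL₂(O)-modules E_{k,ℓ}(O) ⊗_O O/(π) ≅ E_k(F_p) ⊗_{F_p} E_ℓ(F_p), where g ∈ SL₂(O) acts on the first factor E_k through the reduction of g modulo π and on the second factor E_ℓ through the reduction of g modulo σ(π) (equivalently, the reduction of σ(g) modulo π). -/

import Mathlib

/-!
STATEMENT 16: Let `O` be the ring of integers of an imaginary quadratic field `K` with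
complex conjugation `σ`, and let `p` be a rational prime that splits in `O`:
`pO = (π)(σπ)` with `(π) ≠ (σπ)`.  Set `κ = O/(π)` (so `κ ≅ F_p`).  Then for all `k, ℓ ≥ 0`
there is an `SL₂(O)`-equivariant isomorphism
`E_{k,ℓ}(O) ⊗_O κ ≅ E_k(κ) ⊗_κ E_ℓ(κ)`, where `g` acts on the first factor through its
reduction mod `π` and on the second factor through the reduction of `σ(g)` mod `π`
(equivalently, the reduction of `g` mod `σ(π)`).

(`O` is presented as an abstract commutative ring together with a ring isomorphism onto
`NumberField.RingOfIntegers K`.)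
-/

open scoped MatrixGroups TensorProduct

/-- `E k R`: homogeneous polynomials of degree `k` in the two variables `X 0, X 1` over `R`. -/
def EE (R : Type) [CommRing R] (k : ℕ) : Type :=
  MvPolynomial.homogeneousSubmodule (Fin 2) R k

noncomputable instance (R : Type) [CommRing R] (k : ℕ) : AddCommGroup (EE R k) :=
  inferInstanceAs (AddCommGroup (MvPolynomial.homogeneousSubmodule (Fin 2) R k))

noncomputable instance (R : Type) [CommRing R] (k : ℕ) : Module R (EE R k) :=
  inferInstanceAs (Module R (MvPolynomial.homogeneousSubmodule (Fin 2) R k))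

/-- The right action of a 2×2 matrix `g` on `E k R`:
`(P · g)(X, Y) = P (g₀₀ X + g₀₁ Y, g₁₀ X + g₁₁ Y)`.  (On homogeneous polynomials of degree
`k` the substitution is again homogeneous of degree `k`, so taking the `k`-th homogeneous
component after substituting is the genuine action.) -/
noncomputable def polyAct (R : Type) [CommRing R] (k : ℕ) (g : Matrix (Fin 2) (Fin 2) R) :
    EE R k →ₗ[R] EE R k :=
  LinearMap.codRestrict (MvPolynomial.homogeneousSubmodule (Fin 2) R k)
    ((MvPolynomial.homogeneousComponent k) ∘ₗ
      (MvPolynomial.aeval (R := R) (S₁ := MvPolynomial (Fin 2) R)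
        (fun i : Fin 2 => MvPolynomial.C (g i 0) * MvPolynomial.X 0
          + MvPolynomial.C (g i 1) * MvPolynomial.X 1)).toLinearMap ∘ₗ
      (MvPolynomial.homogeneousSubmodule (Fin 2) R k).subtype)
    (fun _ => (MvPolynomial.mem_homogeneousSubmodule _ _).2
      (MvPolynomial.homogeneousComponent_isHomogeneous _ _))

/-- `E_{k,ℓ}(O) = E_k(O) ⊗_O E_ℓ(O)` (second factor to be twisted by conjugation). -/
def EKL (O : Type) [CommRing O] (k l : ℕ) : Type := TensorProduct O (EE O k) (EE O l)

noncomputable instance (O : Type) [CommRing O] (k l : ℕ) : AddCommGroup (EKL O k l) :=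
  inferInstanceAs (AddCommGroup (TensorProduct O (EE O k) (EE O l)))

noncomputable instance (O : Type) [CommRing O] (k l : ℕ) : Module O (EKL O k l) :=
  inferInstanceAs (Module O (TensorProduct O (EE O k) (EE O l)))

/-- The right action of `g` on `E_{k,ℓ}(O)`: `g` on the first factor and the entrywise
conjugate `σ(g)` on the second factor. -/
noncomputable def EklAct (O : Type) [CommRing O] (k l : ℕ) (σ : O ≃+* O)
    (g : Matrix (Fin 2) (Fin 2) O) : EKL O k l →ₗ[O] EKL O k l :=
  TensorProduct.map (polyAct O k g) (polyAct O l (g.map σ))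

/-- The coefficient basis of `EE R k`. -/
noncomputable def EEbasis (R : Type) [CommRing R] (k : ℕ) :
    Module.Basis {d : Fin 2 →₀ ℕ | d.degree = k} R (EE R k) :=
  Module.Basis.ofRepr
    ((LinearEquiv.ofEq _ _ (MvPolynomial.homogeneousSubmodule_eq_finsupp_supported (Fin 2) R k)).trans
      (AddMonoidAlgebra.supportedEquivFinsupp {d : Fin 2 →₀ ℕ | d.degree = k}))

/-- The underlying polynomial. -/
noncomputable def EEval {R : Type} [CommRing R] {k : ℕ} (P : EE R k) : MvPolynomial (Fin 2) R :=
  Subtype.val P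

lemma EEval_injective {R : Type} [CommRing R] {k : ℕ} {P Q : EE R k} (h : EEval P = EEval Q) :
    P = Q := Subtype.ext h

lemma EEval_hom {R : Type} [CommRing R] {k : ℕ} (P : EE R k) :
    (EEval P).IsHomogeneous k := P.2

lemma EEbasis_repr (R : Type) [CommRing R] (k : ℕ) (P : EE R k)
    (d : {d : Fin 2 →₀ ℕ | d.degree = k}) :
    (EEbasis R k).repr P d = (EEval P).coeff d.1 := rfl

/-- Base change of `EE`. -/
noncomputable def EEbc (R S : Type) [CommRing R] [CommRing S] [Algebra R S] (k : ℕ) :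
    (S ⊗[R] EE R k) ≃ₗ[S] EE S k :=
  ((EEbasis R k).baseChange S).equiv (EEbasis S k) (Equiv.refl _)

lemma EEbc_tmul (R S : Type) [CommRing R] [CommRing S] [Algebra R S] (k : ℕ) (P : EE R k) :
    EEval (EEbc R S k (1 ⊗ₜ P)) = MvPolynomial.map (algebraMap R S) (EEval P) := by
  ext d
  by_cases hd : d.degree = k
  · have h : (EEbasis S k).repr (EEbc R S k (1 ⊗ₜ P))
        = ((EEbasis R k).baseChange S).repr (1 ⊗ₜ P) := by
      ext i
      simp [EEbc, Module.Basis.equiv]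
    have h2 := DFunLike.congr_fun h ⟨d, hd⟩
    rw [EEbasis_repr, Module.Basis.baseChange_repr_tmul, EEbasis_repr] at h2
    rw [h2, MvPolynomial.coeff_map, Algebra.smul_def, mul_one]
  · rw [(EEval_hom _).coeff_eq_zero hd, ((EEval_hom P).map _).coeff_eq_zero hd]

lemma EEval_polyAct {R : Type} [CommRing R] (k : ℕ) (g : Matrix (Fin 2) (Fin 2) R) (P : EE R k) :
    EEval (polyAct R k g P) = MvPolynomial.homogeneousComponent k
      (MvPolynomial.aeval (R := R) (S₁ := MvPolynomial (Fin 2) R)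
        (fun i : Fin 2 => MvPolynomial.C (g i 0) * MvPolynomial.X 0
          + MvPolynomial.C (g i 1) * MvPolynomial.X 1) (EEval P)) := rfl

lemma map_homComp {R S : Type} [CommRing R] [CommRing S] (f : R →+* S) (k : ℕ)
    (P : MvPolynomial (Fin 2) R) :
    MvPolynomial.map f (MvPolynomial.homogeneousComponent k P)
      = MvPolynomial.homogeneousComponent k (MvPolynomial.map f P) := by
  ext d
  simp only [MvPolynomial.coeff_map, MvPolynomial.coeff_homogeneousComponent]
  split_ifs <;> simp

lemma EEbc_polyAct (R S : Type) [CommRing R] [CommRing S] [Algebra R S] (k : ℕ)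
    (g : Matrix (Fin 2) (Fin 2) R) (P : EE R k) :
    EEbc R S k (1 ⊗ₜ polyAct R k g P)
      = polyAct S k (g.map (algebraMap R S)) (EEbc R S k (1 ⊗ₜ P)) := by
  apply EEval_injective
  rw [EEbc_tmul, EEval_polyAct, EEval_polyAct, EEbc_tmul, map_homComp]
  congr 1
  rw [MvPolynomial.aeval_def, MvPolynomial.aeval_def, MvPolynomial.eval₂_map,
    MvPolynomial.hom_eval₂]
  congr 1
  · ext <;> simp [MvPolynomial.algebraMap_eq]
  · funext i
    simp

/-- The action of a pair of matrices on `EKL`. -/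
noncomputable def EklPair (R : Type) [CommRing R] (k l : ℕ)
    (g h : Matrix (Fin 2) (Fin 2) R) : EKL R k l →ₗ[R] EKL R k l :=
  TensorProduct.map (polyAct R k g) (polyAct R l h)

lemma EEtensor (R S : Type) [CommRing R] [CommRing S] [Algebra R S] (k l : ℕ) :
    ∃ φ : (S ⊗[R] EKL R k l) ≃ₗ[S] (EE S k ⊗[S] EE S l),
      ∀ (g h : Matrix (Fin 2) (Fin 2) R) (v : S ⊗[R] EKL R k l),
        φ (LinearMap.baseChange S (EklPair R k l g h) v)
          = TensorProduct.map (polyAct S k (g.map (algebraMap R S)))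
              (polyAct S l (h.map (algebraMap R S))) (φ v) := by
  let φ : (S ⊗[R] (EE R k ⊗[R] EE R l)) ≃ₗ[S] (EE S k ⊗[S] EE S l) :=
    (TensorProduct.AlgebraTensorModule.distribBaseChange R S (EE R k) (EE R l)).trans
      (TensorProduct.congr (EEbc R S k) (EEbc R S l))
  have hφ : ∀ (s : S) (m : EE R k) (n : EE R l), φ (s ⊗ₜ (m ⊗ₜ n))
      = s • (EEbc R S k (1 ⊗ₜ m) ⊗ₜ EEbc R S l (1 ⊗ₜ n)) := by
    intro s m n
    have : s ⊗ₜ[R] (m ⊗ₜ[R] n) = s • ((1 : S) ⊗ₜ[R] (m ⊗ₜ[R] n)) := by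
      rw [TensorProduct.smul_tmul', smul_eq_mul, mul_one]
    rw [this, map_smul]
    rfl
  refine ⟨φ, fun g h v => ?_⟩
  change S ⊗[R] (EE R k ⊗[R] EE R l) at v
  change φ (LinearMap.baseChange S (TensorProduct.map (polyAct R k g) (polyAct R l h)) v) = _
  change _ = TensorProduct.map _ _ (φ v)
  induction v using TensorProduct.induction_on with
  | zero => simp
  | add x y hx hy => rw [map_add, map_add, map_add, map_add, hx, hy]
  | tmul s t =>
    induction t using TensorProduct.induction_on with
    | zero => simp
    | add x y hx hy => rw [TensorProduct.tmul_add, map_add, map_add, map_add, map_add, hx, hy]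
    | tmul m n =>
      rw [LinearMap.baseChange_tmul, TensorProduct.map_tmul, hφ, hφ, map_smul,
        TensorProduct.map_tmul, EEbc_polyAct, EEbc_polyAct]

theorem Ekl_mod_split_prime
    (K : Type) [Field K] [NumberField K]
    (hquad : Module.finrank ℚ K = 2) (himag : IsEmpty (K →+* ℝ))
    (O : Type) [CommRing O] (hO : Nonempty (O ≃+* NumberField.RingOfIntegers K))
    (σ : O ≃+* O) (hσ : σ ≠ RingEquiv.refl O)
    (p : ℕ) (hp : p.Prime) (π : O) (hπ : Prime π)
    (hsplit : Ideal.span {(p : O)} = Ideal.span {π} * Ideal.span {σ π})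
    (hne : Ideal.span {π} ≠ Ideal.span ({σ π} : Set O))
    (k l : ℕ) :
    ∃ φ : ((O ⧸ Ideal.span {π}) ⊗[O] EKL O k l) ≃ₗ[O ⧸ Ideal.span {π}]
          (TensorProduct (O ⧸ Ideal.span {π})
            (EE (O ⧸ Ideal.span {π}) k) (EE (O ⧸ Ideal.span {π}) l)),
      ∀ (g : SL(2, O)) (v : (O ⧸ Ideal.span {π}) ⊗[O] EKL O k l),
        φ (LinearMap.baseChange (O ⧸ Ideal.span {π}) (EklAct O k l σ g) v)
          = TensorProduct.map
              (polyAct (O ⧸ Ideal.span {π}) k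
                ((g : Matrix (Fin 2) (Fin 2) O).map (Ideal.Quotient.mk (Ideal.span {π}))))
              (polyAct (O ⧸ Ideal.span {π}) l
                ((g : Matrix (Fin 2) (Fin 2) O).map
                  (fun x => Ideal.Quotient.mk (Ideal.span {π}) (σ x))))
              (φ v) := by
  obtain ⟨φ, h⟩ := EEtensor O (O ⧸ Ideal.span {π}) k l
  exact ⟨φ, fun g v => h g _ v⟩
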